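/- Let G be a graph, m a positive integer, and ε ≤ 1 a real number. Suppose S ⊆ V(G) maximizes Ω_m(G \ S) − ε|S| and, among such sets, has maximal cardinality. Then every connected component of G \ S is either m-tree-connected or has maximum degree at most m. -/

import Mathlib

open SimpleGraph

def IsTreeConn {V : Type*} (m : ℕ) (G : SimpleGraph V) : Prop :=
  ∃ T : Fin m → SimpleGraph V, (∀ i, T i ≤ G) ∧ (∀ i, (T i).IsTree) ∧
    ∀ i j, i ≠ j → Disjoint (T i).edgeSet (T j).edgeSet

noncomputable def eIn {V : Type*} (G : SimpleGraph V) (S : Set V) : ℕ :=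
  {e ∈ G.edgeSet | ∀ v ∈ e, v ∈ S}.ncard

def IsSparse {V : Type*} (m : ℕ) (G : SimpleGraph V) : Prop :=
  ∀ S : Set V, S.Nonempty → (eIn G S : ℤ) ≤ m * S.ncard - m

def mComp {V : Type*} (m : ℕ) (G : SimpleGraph V) (v : V) : Set V :=
  ⋃₀ {X : Set V | v ∈ X ∧ IsTreeConn m (G.induce X)}

noncomputable def crossE {V : Type*} (m : ℕ) (G : SimpleGraph V) : ℕ :=
  {e ∈ G.edgeSet | ∃ u ∈ e, ∃ w ∈ e, mComp m G u ≠ mComp m G w}.ncard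

noncomputable def Omega {V : Type*} (m : ℕ) (G : SimpleGraph V) : ℤ :=
  m * (Set.range (mComp m G)).ncard - crossE m G

section Exchange

variable {K M E : Type*} [Field K] [AddCommGroup M] [Module K M] {m : ℕ}

/-- A partial colouring of `E` all of whose colour classes are linearly independent. -/
def IndepColoring (K : Type*) {M E : Type*} [Field K] [AddCommGroup M] [Module K M] {m : ℕ}
    (φ : E → M) (c : E → Option (Fin m)) : Prop :=
  ∀ i, LinearIndepOn K φ {e | c e = some i}

/-- An independent partial colouring with the largest number of coloured elements. -/
def IsMaxColoring (K : Type*) {M E : Type*} [Field K] [AddCommGroup M] [Module K M] {m : ℕ}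
    (φ : E → M) (c : E → Option (Fin m)) : Prop :=
  IndepColoring K φ c ∧ ∀ c' : E → Option (Fin m), IndepColoring K φ c' →
    {e | c' e ≠ none}.ncard ≤ {e | c e ≠ none}.ncard

theorem exists_isMaxColoring [Finite E] (m : ℕ) (φ : E → M) :
    ∃ c : E → Option (Fin m), IsMaxColoring K φ c := by
  obtain ⟨c, hc, hmax⟩ := Set.exists_max_image {c : E → Option (Fin m) | IndepColoring K φ c}
    (fun c => {e | c e ≠ none}.ncard) (Set.toFinite _) ⟨fun _ => none, fun i => by simp⟩
  exact ⟨c, hc, hmax⟩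

theorem IsMaxColoring.mem_span [Finite E] {φ : E → M} {c : E → Option (Fin m)}
    (hc : IsMaxColoring K φ c) {x : E} (hx : c x = none) (i : Fin m) :
    φ x ∈ Submodule.span K (φ '' {e | c e = some i}) := by
  classical
  by_contra hspan
  have hset (j : Fin m) : {e | Function.update c x (some i) e = some j} =
      if j = i then insert x {e | c e = some i} else {e | c e = some j} := by
    ext e
    by_cases he : e = x
    · subst he
      by_cases hj : j = i <;> simp [hj, hx]
      exact Ne.symm hj
    · by_cases hj : j = i <;> simp [hj, he]
  have hind : IndepColoring K φ (Function.update c x (some i)) := by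
    intro j
    rw [hset]
    split_ifs with hj
    · exact (hc.1 i).insert hspan
    · exact hc.1 j
  have h := hc.2 _ hind
  refine h.not_gt (Set.ncard_lt_ncard ?_ (Set.toFinite _))
  refine ⟨fun e he => ?_, fun h => ?_⟩
  · by_cases hex : e = x
    · simp [hex]
    · simpa [hex] using he
  · have := @h x (by simp)
    exact this hx

theorem IsMaxColoring.comp_swap [DecidableEq E] {φ : E → M} {c : E → Option (Fin m)}
    (hc : IsMaxColoring K φ c) {x y : E} (hind : IndepColoring K φ (c ∘ Equiv.swap x y)) :
    IsMaxColoring K φ (c ∘ Equiv.swap x y) := by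
  refine ⟨hind, fun c' hc' => (hc.2 c' hc').trans_eq ?_⟩
  rw [← Set.ncard_image_of_injective _ (Equiv.swap x y).injective]
  congr 1
  ext e
  simp only [Set.mem_image, Set.mem_ofPred_eq, Function.comp]
  constructor
  · rintro ⟨a, ha, rfl⟩
    simpa using ha
  · exact fun h => ⟨_, h, by simp⟩

/-- An uncoloured element is spanned by those elements of a colour class it can be exchanged
with. -/
theorem IsMaxColoring.mem_span_exchangeable [Finite E] [DecidableEq E] {φ : E → M}
    {c : E → Option (Fin m)} (hc : IsMaxColoring K φ c) {x : E} (hx : c x = none) (i : Fin m) :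
    φ x ∈ Submodule.span K
      (φ '' {y | c y = some i ∧ IndepColoring K φ (c ∘ Equiv.swap x y)}) := by
  obtain ⟨l, hl, hlx⟩ := (Finsupp.mem_span_image_iff_linearCombination K).1 (hc.mem_span hx i)
  rw [Finsupp.mem_span_image_iff_linearCombination]
  refine ⟨l, ?_, hlx⟩
  rw [Finsupp.mem_supported] at hl ⊢
  intro y hy
  have hyi : c y = some i := hl hy
  have hxy : x ≠ y := by rintro rfl; simp [hx] at hyi
  refine ⟨hyi, fun j => ?_⟩
  have hset : {e | (c ∘ Equiv.swap x y) e = some j} =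
      if j = i then insert x ({e | c e = some i} \ {y}) else {e | c e = some j} := by
    ext e
    by_cases hex : e = x
    · subst hex
      by_cases hj : j = i <;> simp [hj, hx, hyi]
      exact Ne.symm hj
    · by_cases hey : e = y
      · subst hey
        by_cases hj : j = i <;> simp [hj, hx, hyi, hex, eq_comm]
        exact fun h => hj h.symm
      · by_cases hj : j = i <;> simp [hj, Equiv.swap_apply_of_ne_of_ne hex hey, hex, hey]
  rw [hset]
  split_ifs with hj
  · refine ((hc.1 i).mono Set.sdiff_subset).insert fun hspan => ?_
    refine linearIndepOn_iff_notMem_span.1 (hc.1 i) y hyi ?_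
    have hsum : l y • φ y + ∑ z ∈ l.support.erase y, l z • φ z = φ x := by
      rw [← hlx, Finsupp.linearCombination_apply, Finsupp.sum,
        Finset.add_sum_erase _ (fun z => l z • φ z) hy]
    rw [← (Submodule.smul_mem_iff _ (Finsupp.mem_support_iff.1 hy) :
      l y • φ y ∈ _ ↔ _), eq_sub_of_add_eq hsum]
    refine Submodule.sub_mem _ hspan (Submodule.sum_mem _ fun z hz => ?_)
    rw [Finset.mem_erase] at hz
    exact Submodule.smul_mem _ _ (Submodule.subset_span ⟨z, ⟨hl hz.2, hz.1⟩, rfl⟩)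
  · exact hc.1 j

/-- An uncoloured element lies in a set spanned by its intersection with every colour class. -/
theorem IsMaxColoring.exists_tight_set [Finite E] {φ : E → M} {c : E → Option (Fin m)}
    (hc : IsMaxColoring K φ c) {x : E} (hx : c x = none) :
    ∃ D : Set E, x ∈ D ∧ ∀ e ∈ D, ∀ i,
      φ e ∈ Submodule.span K (φ '' {y | c y = some i ∧ y ∈ D}) := by
  classical
  let step : (E → Option (Fin m)) → (E → Option (Fin m)) → Prop := fun a b =>
    ∃ x y i, a x = none ∧ a y = some i ∧ IndepColoring K φ b ∧ b = a ∘ Equiv.swap x y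
  let D : Set E := {e | ∃ b, Relation.ReflTransGen step c b ∧ b e = none}
  have hmax {b} (hb : Relation.ReflTransGen step c b) : IsMaxColoring K φ b := by
    induction hb with
    | refl => exact hc
    | tail _ h ih =>
      obtain ⟨x, y, i, -, -, hind, rfl⟩ := h
      exact ih.comp_swap hind
  have hD {b} (hb : Relation.ReflTransGen step c b) {e} (he : b e = none) (i : Fin m) :
      φ e ∈ Submodule.span K (φ '' {y | b y = some i ∧ y ∈ D}) := by
    refine Submodule.span_mono (Set.image_mono ?_) ((hmax hb).mem_span_exchangeable he i)
    rintro y ⟨hy, hind⟩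
    exact ⟨hy, _, hb.tail ⟨e, y, i, he, hy, hind, rfl⟩, by simp [he]⟩
  have hspan {b} (hb : Relation.ReflTransGen step c b) (i : Fin m) :
      Submodule.span K (φ '' {y | b y = some i ∧ y ∈ D}) ≤
        Submodule.span K (φ '' {y | c y = some i ∧ y ∈ D}) := by
    induction hb with
    | refl => exact le_rfl
    | @tail a b ha h ih =>
      refine le_trans ?_ ih
      obtain ⟨x, y, j, hax, hay, hind, rfl⟩ := h
      rw [Submodule.span_le]
      rintro _ ⟨z, ⟨hz, hzD⟩, rfl⟩
      by_cases hzx : z = x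
      · subst hzx
        exact hD ha hax i
      · by_cases hzy : z = y
        · subst hzy
          simp [hax] at hz
        · rw [Function.comp, Equiv.swap_apply_of_ne_of_ne hzx hzy] at hz
          exact Submodule.subset_span ⟨z, ⟨hz, hzD⟩, rfl⟩
  refine ⟨D, ⟨c, .refl, hx⟩, ?_⟩
  rintro e ⟨b, hb, he⟩ i
  exact hspan hb i (hD hb he i)

end Exchange

section Incidence

variable {V Q : Type*} [DecidableEq Q]

/-- The mod 2 incidence vector of an edge after contracting the fibres of `q`. -/
def incVec (q : V → Q) : Sym2 V → Q → ZMod 2 :=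
  Sym2.lift ⟨fun u v => Pi.single (q u) 1 + Pi.single (q v) 1, fun _ _ => add_comm _ _⟩

theorem incVec_mk (q : V → Q) (u v : V) :
    incVec q s(u, v) = Pi.single (q u) 1 + Pi.single (q v) 1 := rfl

theorem ncard_lt_card_of_linearIndepOn_incVec [Fintype Q] [Nonempty Q] {E : Type*} [Finite E]
    (q : V → Q) (f : E → Sym2 V) {I : Set E}
    (hI : LinearIndepOn (ZMod 2) (fun e => incVec q (f e)) I) :
    I.ncard + 1 ≤ Fintype.card Q := by
  have := Fintype.ofFinite I
  let q₀ : Q := Classical.arbitrary Q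
  let σ : (Q → ZMod 2) →ₗ[ZMod 2] ZMod 2 := ∑ a, LinearMap.proj a
  have hσ (a : Q) : σ (Pi.single a 1) = 1 := by simp [σ]
  have hker : Submodule.span (ZMod 2) (Set.range fun e : I => incVec q (f e)) ≤ σ.ker := by
    rw [Submodule.span_le]
    rintro _ ⟨e, rfl⟩
    change σ (incVec q (f e)) = 0
    induction f e with
    | _ u v => rw [incVec_mk, map_add, hσ, hσ]; rfl
  have hq₀ : (Pi.single q₀ 1 : Q → ZMod 2) ∉
      Submodule.span (ZMod 2) (Set.range fun e : I => incVec q (f e)) := by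
    intro h
    have := hker h
    rw [LinearMap.mem_ker, hσ] at this
    exact one_ne_zero this
  have h := (LinearIndependent.option hI hq₀).fintype_card_le_finrank
  rwa [Fintype.card_option, Module.finrank_fintype_fun_eq_card, ← Nat.card_eq_fintype_card,
    Nat.card_coe_set_eq] at h

theorem reflTransGen_of_incVec_mem_span [Finite Q] (q : V → Q) {A : Set (Sym2 V)} {x y : V}
    (h : incVec q s(x, y) ∈ Submodule.span (ZMod 2) (incVec q '' A)) :
    Relation.ReflTransGen (fun a b => s(a, b) ∈ A ∨ q a = q b) x y := by
  classical
  have := Fintype.ofFinite Q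
  let r : V → V → Prop := fun a b => s(a, b) ∈ A ∨ q a = q b
  let χ : Q → ZMod 2 := fun a => if ∃ z, Relation.ReflTransGen r x z ∧ q z = a then 1 else 0
  have hχ (z : V) : χ (q z) = if Relation.ReflTransGen r x z then 1 else 0 := by
    refine if_congr ⟨?_, fun hz => ⟨z, hz, rfl⟩⟩ rfl rfl
    rintro ⟨w, hw, hwz⟩
    exact hw.tail (.inr hwz)
  let g : (Q → ZMod 2) →ₗ[ZMod 2] ZMod 2 := ∑ a, χ a • LinearMap.proj a
  have hg (u v : V) : g (incVec q s(u, v)) = χ (q u) + χ (q v) := by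
    simp [g, incVec_mk, mul_add, Finset.sum_add_distrib, Pi.single_apply]
  have hker : Submodule.span (ZMod 2) (incVec q '' A) ≤ g.ker := by
    rw [Submodule.span_le]
    rintro _ ⟨e, he, rfl⟩
    change g (incVec q e) = 0
    induction e with
    | _ u v =>
      have huv : Relation.ReflTransGen r x u ↔ Relation.ReflTransGen r x v :=
        ⟨fun h => h.tail (.inl he), fun h => h.tail (.inl (Sym2.eq_swap ▸ he))⟩
      rw [hg, hχ, hχ, if_congr huv rfl rfl]
      exact CharTwo.add_self_eq_zero _
  have hxy : g (incVec q s(x, y)) = 0 := hker h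
  rw [hg, hχ, hχ, if_pos .refl] at hxy
  by_contra hy
  simp [r, if_neg hy] at hxy

/-- Either an edge set `F` satisfies the Nash-Williams counting bound for `m` forests after
contracting the fibres of `q`, or it contains `m` disjoint subsets, all with the same
connectivity as a common nonempty superset in `F`. -/
theorem ncard_add_le_or_exists_tight [Finite V] [Fintype Q] [Nonempty Q] (m : ℕ) (q : V → Q)
    (F : Set (Sym2 V)) :
    F.ncard + m ≤ m * Fintype.card Q ∨
      ∃ (D : Set (Sym2 V)) (I : Fin m → Set (Sym2 V)), D ⊆ F ∧ D.Nonempty ∧ (∀ i, I i ⊆ D) ∧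
        (∀ i j, i ≠ j → Disjoint (I i) (I j)) ∧
        ∀ i x y, s(x, y) ∈ D →
          Relation.ReflTransGen (fun a b => s(a, b) ∈ I i ∨ q a = q b) x y := by
  obtain ⟨c, hc⟩ := exists_isMaxColoring (K := ZMod 2) m (fun e : F => incVec q e)
  by_cases hcov : ∀ e, c e ≠ none
  · left
    have hF : F.ncard = (⋃ i, {e | c e = some i}).ncard := by
      rw [← Nat.card_coe_set_eq, ← Set.ncard_univ]
      congr 1
      ext e
      simpa [Option.ne_none_iff_exists', eq_comm] using hcov e
    have hsum : (⋃ i, {e | c e = some i}).ncard ≤ ∑ i, {e | c e = some i}.ncard := by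
      simpa using Finset.set_ncard_biUnion_le Finset.univ (fun i => {e | c e = some i})
    calc F.ncard + m ≤ (∑ i : Fin m, {e | c e = some i}.ncard) + m := by lia
      _ = ∑ i : Fin m, ({e | c e = some i}.ncard + 1) := by simp [Finset.sum_add_distrib]
      _ ≤ ∑ i : Fin m, Fintype.card Q := Finset.sum_le_sum fun i _ =>
          ncard_lt_card_of_linearIndepOn_incVec q Subtype.val (hc.1 i)
      _ = m * Fintype.card Q := by simp
  · right
    push Not at hcov
    obtain ⟨x, hx⟩ := hcov
    obtain ⟨D, hxD, hD⟩ := hc.exists_tight_set hx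
    refine ⟨Subtype.val '' D, fun i => Subtype.val '' {e | c e = some i ∧ e ∈ D}, ?_,
      ⟨x, x, hxD, rfl⟩,
      fun i => Set.image_mono fun e he => he.2, fun i j hij => ?_, fun i u v huv => ?_⟩
    · rintro _ ⟨e, -, rfl⟩
      exact e.2
    · rw [Set.disjoint_image_iff Subtype.val_injective, Set.disjoint_left]
      rintro e ⟨hi, -⟩ ⟨hj, -⟩
      exact hij (Option.some_injective _ (hi.symm.trans hj))
    · obtain ⟨e, he, heuv⟩ := huv
      apply reflTransGen_of_incVec_mem_span
      rw [← heuv, Set.image_image]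
      exact hD e he i

end Incidence

section TreeConnOn

variable {V : Type*} {m : ℕ} {G : SimpleGraph V}

/-- The set `U` is nonempty and is connected by each of `m` edge-disjoint subgraphs of `G`. -/
def TreeConnOn (m : ℕ) (G : SimpleGraph V) (U : Set V) : Prop :=
  U.Nonempty ∧ ∃ A : Fin m → SimpleGraph V, (∀ i, A i ≤ G) ∧
    (∀ i x y, (A i).Adj x y → x ∈ U ∧ y ∈ U) ∧
    (∀ i, ∀ x ∈ U, ∀ y ∈ U, (A i).Reachable x y) ∧
    ∀ i j, i ≠ j → ∀ x y, (A i).Adj x y → ¬(A j).Adj x y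

theorem reachable_comap_subtype {A : SimpleGraph V} {W : Set V}
    (hA : ∀ x y, A.Adj x y → y ∈ W) {x y : V} (h : A.Reachable x y) (hx : x ∈ W) (hy : y ∈ W) :
    (A.comap (Subtype.val : W → V)).Reachable ⟨x, hx⟩ ⟨y, hy⟩ := by
  rw [reachable_iff_reflTransGen] at h
  induction h with
  | refl => exact .rfl
  | @tail b c _ hbc ih =>
    have hadj : (A.comap (Subtype.val : W → V)).Adj ⟨b, hA _ _ hbc.symm⟩ ⟨c, hy⟩ := hbc
    exact (ih _).trans hadj.reachable

theorem reachable_map_subtype {W : Set V} {T : SimpleGraph W} {x y : W} (h : T.Reachable x y) :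
    (T.map (Function.Embedding.subtype (· ∈ W))).Reachable x y :=
  h.map (SimpleGraph.Embedding.map (Function.Embedding.subtype (· ∈ W)) T).toHom

theorem map_subtype_adj {W : Set V} {T : SimpleGraph W} {x y : V} :
    (T.map (Function.Embedding.subtype (· ∈ W))).Adj x y ↔
      ∃ (hx : x ∈ W) (hy : y ∈ W), T.Adj ⟨x, hx⟩ ⟨y, hy⟩ := by
  rw [SimpleGraph.map_adj]
  constructor
  · rintro ⟨u, v, h, rfl, rfl⟩
    exact ⟨u.2, v.2, h⟩
  · rintro ⟨hx, hy, h⟩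
    exact ⟨_, _, h, rfl, rfl⟩

theorem isTreeConn_induce_iff (hm : 0 < m) {U : Set V} :
    IsTreeConn m (G.induce U) ↔ TreeConnOn m G U := by
  constructor
  · rintro ⟨T, hTG, hT, hdisj⟩
    obtain ⟨u⟩ := (hT ⟨0, hm⟩).connected.nonempty
    refine ⟨⟨u, u.2⟩, fun i => (T i).map (Function.Embedding.subtype (· ∈ U)),
      fun i x y h => ?_, fun i x y h => ?_, fun i x hx y hy => ?_, fun i j hij x y hi hj => ?_⟩
    · obtain ⟨hx, hy, h⟩ := map_subtype_adj.1 h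
      exact hTG i h
    · obtain ⟨hx, hy, -⟩ := map_subtype_adj.1 h
      exact ⟨hx, hy⟩
    · exact reachable_map_subtype ((hT i).connected.preconnected ⟨x, hx⟩ ⟨y, hy⟩)
    · obtain ⟨hx, hy, hi⟩ := map_subtype_adj.1 hi
      obtain ⟨_, _, hj'⟩ := map_subtype_adj.1 hj
      exact Set.disjoint_left.1 (hdisj i j hij) (show s(_, _) ∈ (T i).edgeSet from hi) hj'
  · rintro ⟨⟨u, hu⟩, A, hAG, hAU, hA, hdisj⟩
    have hconn (i : Fin m) : ((A i).comap (Subtype.val : U → V)).Connected :=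
      { preconnected := fun x y =>
          reachable_comap_subtype (fun a b h => (hAU i a b h).2) (hA i x x.2 y y.2) x.2 y.2
        nonempty := ⟨⟨u, hu⟩⟩ }
    choose T hTA hT using fun i => (hconn i).exists_isTree_le
    refine ⟨T, fun i => (hTA i).trans fun x y h => hAG i h, hT, fun i j hij => ?_⟩
    rw [Set.disjoint_left]
    intro e
    induction e with
    | _ x y => exact fun hi hj => hdisj i j hij x y (hTA i hi) (hTA j hj)

theorem treeConnOn_induce_iff {W : Set V} {X : Set W} :
    TreeConnOn m (G.induce W) X ↔ TreeConnOn m G (Subtype.val '' X) := by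
  constructor
  · rintro ⟨hX, A, hAG, hAU, hA, hdisj⟩
    refine ⟨hX.image _, fun i => (A i).map (Function.Embedding.subtype (· ∈ W)),
      fun i x y h => ?_, fun i x y h => ?_, ?_, fun i j hij x y hi hj => ?_⟩
    · obtain ⟨hx, hy, h⟩ := map_subtype_adj.1 h
      exact hAG i h
    · obtain ⟨hx, hy, h⟩ := map_subtype_adj.1 h
      exact ⟨⟨_, (hAU i _ _ h).1, rfl⟩, ⟨_, (hAU i _ _ h).2, rfl⟩⟩
    · rintro i _ ⟨x, hx, rfl⟩ _ ⟨y, hy, rfl⟩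
      exact reachable_map_subtype (hA i x hx y hy)
    · obtain ⟨hx, hy, hi⟩ := map_subtype_adj.1 hi
      obtain ⟨_, _, hj'⟩ := map_subtype_adj.1 hj
      exact hdisj i j hij _ _ hi hj'
  · rintro ⟨hX, A, hAG, hAU, hA, hdisj⟩
    refine ⟨Set.image_nonempty.1 hX, fun i => (A i).comap Subtype.val, fun i x y h => hAG i h,
      fun i x y h => ?_, fun i x hx y hy => ?_, fun i j hij x y => hdisj i j hij x y⟩
    · simpa using hAU i x y h
    · refine reachable_comap_subtype (fun a b h => ?_) (hA i x ⟨x, hx, rfl⟩ y ⟨y, hy, rfl⟩) x.2 y.2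
      obtain ⟨z, -, rfl⟩ := (hAU i a b h).2
      exact z.2

theorem treeConnOn_singleton (m : ℕ) (G : SimpleGraph V) (v : V) : TreeConnOn m G {v} := by
  refine ⟨⟨v, rfl⟩, fun _ => ⊥, fun _ => bot_le, by simp, ?_, by simp⟩
  rintro i x rfl y rfl
  exact .rfl

/-- Gluing disjoint `m`-tree-connected sets along edge sets that connect them `m` times. -/
theorem TreeConnOn.glue {U : Set V} {C : V → Set V} {B : Fin m → Set (Sym2 V)}
    (hU : U.Nonempty) (hC : ∀ x ∈ U, TreeConnOn m G (C x)) (hself : ∀ x, x ∈ C x)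
    (hCU : ∀ x ∈ U, C x ⊆ U) (hBG : ∀ i, B i ⊆ G.edgeSet)
    (hCeq : ∀ x ∈ U, ∀ y ∈ C x, C y = C x)
    (hBU : ∀ i x y, s(x, y) ∈ B i → x ∈ U → y ∈ U)
    (hdisj : ∀ i j, i ≠ j → Disjoint (B i) (B j))
    (hcross : ∀ i x y, s(x, y) ∈ B i → C x ≠ C y)
    (hconn : ∀ i, ∀ x ∈ U, ∀ y ∈ U,
      Relation.ReflTransGen (fun a b => s(a, b) ∈ B i ∨ C a = C b) x y) :
    TreeConnOn m G U := by
  have hT : ∀ X, TreeConnOn m G X → _ := fun X h => h.2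
  choose! T hTG hTU hT hTdisj using hT
  let A (i : Fin m) : SimpleGraph V :=
    { Adj x y := x ∈ U ∧ y ∈ U ∧ (s(x, y) ∈ B i ∨ C x = C y ∧ (T (C x) i).Adj x y)
      symm := ⟨by
        rintro x y ⟨hx, hy, h⟩
        refine ⟨hy, hx, h.imp (fun h => Sym2.eq_swap ▸ h) fun h => ⟨h.1.symm, ?_⟩⟩
        exact h.1 ▸ h.2.symm⟩
      loopless := ⟨by
        rintro x ⟨hx, -, h | h⟩
        · exact G.loopless.irrefl x (hBG i h)
        · exact (T (C x) i).loopless.irrefl x h.2⟩ }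
  refine ⟨hU, A, ?_, fun i x y h => ⟨h.1, h.2.1⟩, fun i x hx y hy => ?_, ?_⟩
  · rintro i x y ⟨hx, hy, h | h⟩
    · exact hBG i h
    · exact hTG _ (hC x hx) i h.2
  · have key : y ∈ U ∧ (A i).Reachable x y := by
      have h := hconn i x hx y hy
      clear hy
      induction h with
      | refl => exact ⟨hx, .rfl⟩
      | @tail b c _ hbc ih =>
        obtain ⟨hb, ih⟩ := ih
        rcases hbc with hbc | hbc
        · have hc := hBU i b c hbc hb
          have hadj : (A i).Adj b c := ⟨hb, hc, .inl hbc⟩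
          exact ⟨hc, ih.trans hadj.reachable⟩
        · have hcb : c ∈ C b := hbc ▸ hself c
          refine ⟨hCU b hb hcb, ih.trans ?_⟩
          refine (hT _ (hC b hb) i b (hself b) c hcb).mono fun u v huv => ?_
          obtain ⟨hu, hv⟩ := hTU _ (hC b hb) i u v huv
          refine ⟨hCU b hb hu, hCU b hb hv, .inr ⟨?_, ?_⟩⟩
          · rw [hCeq b hb u hu, hCeq b hb v hv]
          · rwa [hCeq b hb u hu]
    exact key.2
  · rintro i j hij x y ⟨hx, hy, hi | hi⟩ ⟨-, -, hj | hj⟩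
    · exact Set.disjoint_left.1 (hdisj i j hij) hi hj
    · exact hcross i x y hi hj.1
    · exact hcross j x y hj hi.1
    · exact hTdisj _ (hC x hx) i j hij x y hi.2 hj.2

theorem symmetric_edge_or_eq {α : Type*} (A : Set (Sym2 V)) (q : V → α) :
    Std.Symm (fun a b => s(a, b) ∈ A ∨ q a = q b) :=
  ⟨fun _ _ h => h.imp (fun h => Sym2.eq_swap ▸ h) Eq.symm⟩

theorem TreeConnOn.union {X Y : Set V} (hX : TreeConnOn m G X) (hY : TreeConnOn m G Y) {z : V}
    (hzX : z ∈ X) (hzY : z ∈ Y) : TreeConnOn m G (X ∪ Y) := by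
  classical
  obtain ⟨-, A, hAG, hAY, hA, hdisj⟩ := hY
  let C : V → Set V := fun x => if x ∈ X then X else {x}
  have hCX {x} (hx : x ∈ X) : C x = X := if_pos hx
  have hCX' {x} (hx : x ∉ X) : C x = {x} := if_neg hx
  have hself (x : V) : x ∈ C x := by by_cases hx : x ∈ X <;> simp [C, hx]
  let B : Fin m → Set (Sym2 V) := fun i => {e ∈ (A i).edgeSet | ¬∀ v ∈ e, v ∈ X}
  have hz (i : Fin m) (x : V) (hx : x ∈ X ∪ Y) :
      Relation.ReflTransGen (fun a b => s(a, b) ∈ B i ∨ C a = C b) x z := by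
    rcases hx with hx | hx
    · exact .single (.inr ((hCX hx).trans (hCX hzX).symm))
    · refine Relation.ReflTransGen.mono (fun a b hab => ?_) x z
        ((reachable_iff_reflTransGen _ _).1 (hA i x hx z hzY))
      by_cases h : a ∈ X ∧ b ∈ X
      · exact .inr ((hCX h.1).trans (hCX h.2).symm)
      · exact .inl ⟨hab, by simpa using h⟩
  refine TreeConnOn.glue (C := C) (B := B) ⟨z, .inl hzX⟩ (fun x _ => ?_) hself (fun x hx => ?_)
    (fun i e he => ?_) (fun x _ y hy => ?_) (fun i x y h _ => .inr (hAY i x y h.1).2)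
    (fun i j hij => ?_) (fun i x y h hC => ?_) (fun i x hx y hy => ?_)
  · by_cases hx : x ∈ X
    · rwa [hCX hx]
    · rw [hCX' hx]
      exact treeConnOn_singleton m G x
  · by_cases hxX : x ∈ X
    · rw [hCX hxX]
      exact Set.subset_union_left
    · rw [hCX' hxX]
      exact Set.singleton_subset_iff.2 hx
  · exact edgeSet_mono (hAG i) he.1
  · by_cases hx : x ∈ X
    · rw [hCX hx] at hy ⊢
      exact hCX hy
    · rw [hCX' hx] at hy
      rw [Set.mem_singleton_iff.1 hy]
  · rw [Set.disjoint_left]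
    intro e
    induction e with
    | _ x y => exact fun hi hj => hdisj i j hij x y hi.1 hj.1
  · have hyx : y ∈ C x := hC ▸ hself y
    by_cases hx : x ∈ X
    · rw [hCX hx] at hyx
      exact h.2 (by simp [hx, hyx])
    · rw [hCX' hx] at hyx
      exact (A i).loopless.irrefl x (Set.mem_singleton_iff.1 hyx ▸ h.1)
  · have := symmetric_edge_or_eq (B i) C
    exact (hz i x hx).trans (Std.Symm.symm _ _ (hz i y hy))

end TreeConnOn

section Components

variable {V : Type*} {m : ℕ} {G : SimpleGraph V}

/-- The `m`-tree-connected component of `v` in `G[W]`, as a set of vertices of `G`. -/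
def compIn (m : ℕ) (G : SimpleGraph V) (W : Set V) (v : V) : Set V :=
  ⋃₀ {X : Set V | X ⊆ W ∧ v ∈ X ∧ TreeConnOn m G X}

theorem subset_compIn {W X : Set V} {v : V} (hXW : X ⊆ W) (hv : v ∈ X) (hX : TreeConnOn m G X) :
    X ⊆ compIn m G W v :=
  Set.subset_sUnion_of_mem ⟨hXW, hv, hX⟩

theorem compIn_subset (m : ℕ) (G : SimpleGraph V) (W : Set V) (v : V) : compIn m G W v ⊆ W :=
  Set.sUnion_subset fun _ h => h.1

theorem mem_compIn_self (m : ℕ) (G : SimpleGraph V) {W : Set V} {v : V} (hv : v ∈ W) :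
    v ∈ compIn m G W v :=
  subset_compIn (Set.singleton_subset_iff.2 hv) rfl (treeConnOn_singleton m G v) rfl

theorem treeConnOn_compIn [Finite V] (m : ℕ) (G : SimpleGraph V) {W : Set V} {v : V}
    (hv : v ∈ W) : TreeConnOn m G (compIn m G W v) := by
  obtain ⟨X, ⟨hXW, hvX, hX⟩, hmax⟩ :=
    (Set.toFinite {X : Set V | X ⊆ W ∧ v ∈ X ∧ TreeConnOn m G X}).exists_maximal
      ⟨{v}, Set.singleton_subset_iff.2 hv, rfl, treeConnOn_singleton m G v⟩
  have h : compIn m G W v = X := by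
    refine (Set.sUnion_subset ?_).antisymm (subset_compIn hXW hvX hX)
    rintro Y ⟨hYW, hvY, hY⟩
    have := hmax ⟨Set.union_subset hXW hYW, .inl hvX, hX.union hY hvX hvY⟩ Set.subset_union_left
    exact Set.subset_union_right.trans this
  rwa [h]

theorem compIn_eq_of_mem [Finite V] {W : Set V} {v w : V} (hw : w ∈ compIn m G W v) :
    compIn m G W w = compIn m G W v := by
  have hwW := compIn_subset m G W v hw
  have hv : v ∈ W := by
    obtain ⟨X, ⟨hXW, hvX, -⟩, -⟩ := hw
    exact hXW hvX
  have h := subset_compIn (compIn_subset m G W v) hw (treeConnOn_compIn m G hv)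
  exact (subset_compIn (compIn_subset m G W w) (h (mem_compIn_self m G hv))
    (treeConnOn_compIn m G hwW)).antisymm h

theorem image_mComp_induce (hm : 0 < m) (W : Set V) (v : W) :
    Subtype.val '' mComp m (G.induce W) v = compIn m G W v := by
  ext x
  constructor
  · rintro ⟨x, ⟨X, ⟨hvX, hX⟩, hx⟩, rfl⟩
    rw [isTreeConn_induce_iff hm, treeConnOn_induce_iff] at hX
    exact subset_compIn (by simp) (Set.mem_image_of_mem _ hvX) hX (Set.mem_image_of_mem _ hx)
  · rintro ⟨X, ⟨hXW, hvX, hX⟩, hx⟩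
    refine ⟨⟨x, hXW hx⟩, ⟨Subtype.val ⁻¹' X, ⟨hvX, ?_⟩, hx⟩, rfl⟩
    rwa [isTreeConn_induce_iff hm, treeConnOn_induce_iff, Subtype.image_preimage_coe,
      Set.inter_eq_right.2 hXW]

theorem mComp_eq_compIn (hm : 0 < m) (v : V) : mComp m G v = compIn m G Set.univ v := by
  simp [mComp, compIn, isTreeConn_induce_iff hm]

/-- The edges of `G[W]` joining distinct `m`-tree-connected components. -/
def crossIn (m : ℕ) (G : SimpleGraph V) (W : Set V) : Set (Sym2 V) :=
  {e ∈ G.edgeSet | (∀ v ∈ e, v ∈ W) ∧ ∃ u ∈ e, ∃ w ∈ e, compIn m G W u ≠ compIn m G W w}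

theorem exists_mem_mk_ne_iff {α : Type*} {f : V → α} {x y : V} :
    (∃ u ∈ s(x, y), ∃ w ∈ s(x, y), f u ≠ f w) ↔ f x ≠ f y := by
  simp only [Sym2.mem_iff, exists_eq_or_imp, exists_eq_left]
  simp [eq_comm]

theorem mk_mem_crossIn {W : Set V} {x y : V} :
    s(x, y) ∈ crossIn m G W ↔
      G.Adj x y ∧ x ∈ W ∧ y ∈ W ∧ compIn m G W x ≠ compIn m G W y := by
  simp only [crossIn, Set.mem_ofPred_eq, exists_mem_mk_ne_iff, Sym2.ball, mem_edgeSet, and_assoc]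

theorem omega_induce (hm : 0 < m) (W : Set V) :
    Omega m (G.induce W) = m * (compIn m G W '' W).ncard - (crossIn m G W).ncard := by
  have h₁ : (Set.range (mComp m (G.induce W))).ncard = (compIn m G W '' W).ncard := by
    rw [← Set.ncard_image_of_injective _
      (Set.image_injective.2 (Subtype.val_injective (p := (· ∈ W)))),
      ← Set.range_comp]
    congr 1
    ext X
    simp [image_mComp_induce hm]
  have h₂ : crossE m (G.induce W) = (crossIn m G W).ncard := by
    rw [crossE, ← Set.ncard_image_of_injective _
      (Sym2.map.injective (Subtype.val_injective (p := (· ∈ W))))]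
    congr 1
    have heq (a b : W) : mComp m (G.induce W) a = mComp m (G.induce W) b ↔
        compIn m G W a = compIn m G W b := by
      rw [← image_mComp_induce hm, ← image_mComp_induce hm,
        (Set.image_injective.2 Subtype.val_injective).eq_iff]
    have hmk (a b : W) : s(a, b) ∈ {e ∈ (G.induce W).edgeSet | ∃ u ∈ e, ∃ w ∈ e,
        mComp m (G.induce W) u ≠ mComp m (G.induce W) w} ↔ s(a.1, b.1) ∈ crossIn m G W := by
      simp only [mk_mem_crossIn, exists_mem_mk_ne_iff, Set.mem_ofPred_eq, mem_edgeSet, ne_eq, heq,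
        induce_adj, Subtype.coe_prop, true_and]
    ext e
    induction e with
    | _ x y =>
      constructor
      · rintro ⟨e, he, hxy⟩
        induction e with
        | _ a b =>
          rw [← hxy]
          exact (hmk a b).1 he
      · intro h
        obtain ⟨-, hx, hy, -⟩ := mk_mem_crossIn.1 h
        exact ⟨s(⟨x, hx⟩, ⟨y, hy⟩), (hmk _ _).2 h, rfl⟩
  rw [Omega, h₁, h₂]

theorem ncard_range_compIn_bound [Finite V] [Nonempty V] (m : ℕ) (G : SimpleGraph V) :
    (crossIn m G Set.univ).ncard + m ≤ m * (Set.range (compIn m G Set.univ)).ncard := by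
  classical
  have := Fintype.ofFinite (Set.range (compIn m G Set.univ))
  have hC (x : V) := treeConnOn_compIn m G (Set.mem_univ x)
  have hself (x : V) := mem_compIn_self m G (Set.mem_univ x)
  rcases ncard_add_le_or_exists_tight m (Set.rangeFactorization (compIn m G Set.univ))
    (crossIn m G Set.univ) with h | ⟨D, I, hDF, ⟨e, he⟩, hID, hdisj, hDI⟩
  · rwa [← Nat.card_eq_fintype_card, Nat.card_coe_set_eq] at h
  · exfalso
    simp only [Set.rangeFactorization_eq_rangeFactorization_iff] at hDI
    induction e with
    | _ u v =>
    have hs (A : Set (Sym2 V)) := symmetric_edge_or_eq A (compIn m G Set.univ)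
    let U : Set V :=
      {x | Relation.ReflTransGen (fun a b => s(a, b) ∈ D ∨
        compIn m G Set.univ a = compIn m G Set.univ b) u x}
    have hU : TreeConnOn m G U := by
      refine TreeConnOn.glue (C := compIn m G Set.univ) (B := I) ⟨u, .refl⟩ (fun x _ => hC x) hself
        (fun x hx y hy => hx.tail (.inr (compIn_eq_of_mem hy).symm))
        (fun i e he => (hDF (hID i he)).1) (fun x _ y hy => compIn_eq_of_mem hy)
        (fun i x y h hx => hx.tail (.inl (hID i h))) hdisj
        (fun i x y h => (mk_mem_crossIn.1 (hDF (hID i h))).2.2.2) (fun i x hx y hy => ?_)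
      have := hs D
      have hxy := (Std.Symm.symm _ _ hx).trans hy
      clear hy
      induction hxy with
      | refl => exact .refl
      | tail _ hbc ih =>
        rcases hbc with hbc | hbc
        · exact ih.trans (hDI i _ _ hbc)
        · exact ih.tail (.inr hbc)
    have hv : v ∈ compIn m G Set.univ u :=
      subset_compIn (Set.subset_univ _) (.refl : u ∈ U) hU (Relation.ReflTransGen.single (.inl he))
    exact (mk_mem_crossIn.1 (hDF he)).2.2.2 (compIn_eq_of_mem hv).symm

/-- `Omega m G` is at least `m` for every nonempty graph. -/
theorem le_omega [Finite V] [Nonempty V] (hm : 0 < m) (G : SimpleGraph V) : (m : ℤ) ≤ Omega m G := by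
  have h := ncard_range_compIn_bound m G
  have h₁ : mComp m G = compIn m G Set.univ := funext fun v => mComp_eq_compIn hm v
  have h₂ : crossE m G = (crossIn m G Set.univ).ncard := by
    simp [crossE, crossIn, h₁]
  rw [Omega, h₁, h₂]
  zify at h
  lia

end Components

section Deletion

variable {V : Type*} [Finite V] {m : ℕ} {G : SimpleGraph V}

theorem compIn_sdiff_of_notMem {W : Set V} {u v : V} (hv : v ∈ W) (huv : v ∉ compIn m G W u) :
    compIn m G (W \ {u}) v = compIn m G W v := by
  have hu : u ∉ compIn m G W v := fun h => huv (by
    rw [compIn_eq_of_mem h]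
    exact mem_compIn_self m G hv)
  have hsub : compIn m G W v ⊆ W \ {u} := fun x hx =>
    ⟨compIn_subset m G W v hx, fun hxu => hu (hxu ▸ hx)⟩
  have hvu : v ∈ W \ {u} := hsub (mem_compIn_self m G hv)
  exact (subset_compIn ((compIn_subset m G _ v).trans Set.sdiff_subset)
    (mem_compIn_self m G hvu) (treeConnOn_compIn m G hvu)).antisymm
    (subset_compIn hsub (mem_compIn_self m G hv) (treeConnOn_compIn m G hv))

theorem compIn_sdiff_of_mem {W : Set V} {u v : V} (hv : v ∈ compIn m G W u \ {u}) :
    compIn m G (W \ {u}) v = compIn m G (compIn m G W u \ {u}) v := by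
  have hvu : v ∈ W \ {u} := ⟨compIn_subset m G W u hv.1, hv.2⟩
  have hTC := treeConnOn_compIn m G hvu
  have hself := mem_compIn_self m G hvu
  have hsub : compIn m G (W \ {u}) v ⊆ compIn m G W u \ {u} := fun x hx => by
    refine ⟨?_, (compIn_subset m G _ v hx).2⟩
    rw [← compIn_eq_of_mem hv.1]
    exact subset_compIn ((compIn_subset m G _ v).trans Set.sdiff_subset) hself hTC hx
  exact (subset_compIn hsub hself hTC).antisymm
    (subset_compIn ((compIn_subset m G _ v).trans
      (Set.sdiff_subset_sdiff_left (compIn_subset m G W u)))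
      (mem_compIn_self m G hv) (treeConnOn_compIn m G hv))

theorem ncard_comps_sdiff (m : ℕ) (G : SimpleGraph V) {W : Set V} {u : V} (hu : u ∈ W) :
    (compIn m G W '' W).ncard + (compIn m G (compIn m G W u \ {u}) '' (compIn m G W u \ {u})).ncard ≤
      (compIn m G (W \ {u}) '' (W \ {u})).ncard + 1 := by
  set X := compIn m G W u with hX
  have hsub : compIn m G W '' W \ {X} ∪ compIn m G (X \ {u}) '' (X \ {u}) ⊆
      compIn m G (W \ {u}) '' (W \ {u}) := by
    rintro _ (⟨⟨v, hv, rfl⟩, hvX⟩ | ⟨v, hv, rfl⟩)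
    · have hvX' : v ∉ X := fun h => hvX (compIn_eq_of_mem h)
      refine ⟨v, ⟨hv, ?_⟩, compIn_sdiff_of_notMem hv hvX'⟩
      rintro rfl
      exact hvX' (mem_compIn_self m G hv)
    · exact ⟨v, ⟨compIn_subset m G W u hv.1, hv.2⟩, compIn_sdiff_of_mem hv⟩
  have hdisj : Disjoint (compIn m G W '' W \ {X}) (compIn m G (X \ {u}) '' (X \ {u})) := by
    rw [Set.disjoint_left]
    rintro _ ⟨⟨v, hv, rfl⟩, hvX⟩ ⟨w, hw, hwv⟩
    have hvX' : v ∈ X :=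
      (compIn_subset m G _ w (hwv ▸ mem_compIn_self m G hv)).1
    exact hvX (compIn_eq_of_mem hvX')
  have h₁ := Set.ncard_le_ncard hsub (Set.toFinite _)
  rw [Set.ncard_union_eq hdisj (Set.toFinite _) (Set.toFinite _)] at h₁
  have h₂ := Set.ncard_sdiff_singleton_add_one (Set.mem_image_of_mem (compIn m G W) hu)
    (Set.toFinite _)
  lia

theorem ncard_crossIn_sdiff (m : ℕ) (G : SimpleGraph V) {W : Set V} {u : V} (hu : u ∈ W) :
    (crossIn m G (W \ {u})).ncard + {z ∈ W \ compIn m G W u | G.Adj u z}.ncard ≤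
      (crossIn m G W).ncard + (crossIn m G (compIn m G W u \ {u})).ncard := by
  set X := compIn m G W u with hX
  set out : Set V := {z ∈ W \ X | G.Adj u z}
  have hinj : Function.Injective (fun z => s(u, z)) := fun a b h => Sym2.congr_right.1 h
  have hout_sub : (fun z => s(u, z)) '' out ⊆ crossIn m G W := by
    rintro _ ⟨z, ⟨⟨hzW, hzX⟩, huz⟩, rfl⟩
    refine mk_mem_crossIn.2 ⟨huz, hu, hzW, fun h => hzX ?_⟩
    rw [hX, h]
    exact mem_compIn_self m G hzW
  have hsub : crossIn m G (W \ {u}) ⊆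
      crossIn m G W \ (fun z => s(u, z)) '' out ∪ crossIn m G (X \ {u}) := by
    intro e he
    induction e with
    | _ x y =>
      obtain ⟨hxy, hx, hy, hne⟩ := mk_mem_crossIn.1 he
      by_cases hXY : compIn m G W x = compIn m G W y
      · right
        have hxX : x ∈ X := by
          by_contra hxX
          have hyX : y ∉ X := fun h => hxX (by
            rw [hX, ← compIn_eq_of_mem h, ← hXY]
            exact mem_compIn_self m G hx.1)
          rw [compIn_sdiff_of_notMem hx.1 hxX, compIn_sdiff_of_notMem hy.1 hyX] at hne
          exact hne hXY
        have hyX : y ∈ X := by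
          rw [hX, ← compIn_eq_of_mem hxX, hXY]
          exact mem_compIn_self m G hy.1
        rw [compIn_sdiff_of_mem ⟨hxX, hx.2⟩, compIn_sdiff_of_mem ⟨hyX, hy.2⟩] at hne
        exact mk_mem_crossIn.2 ⟨hxy, ⟨hxX, hx.2⟩, ⟨hyX, hy.2⟩, hne⟩
      · left
        refine ⟨mk_mem_crossIn.2 ⟨hxy, hx.1, hy.1, hXY⟩, ?_⟩
        rintro ⟨z, -, hz⟩
        rcases Sym2.eq_iff.1 hz with ⟨h, -⟩ | ⟨h, -⟩
        · exact hx.2 h.symm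
        · exact hy.2 h.symm
  have h₁ := (Set.ncard_le_ncard hsub (Set.toFinite _)).trans (Set.ncard_union_le _ _)
  have h₂ := Set.ncard_sdiff_add_ncard_of_subset hout_sub (Set.toFinite _)
  rw [Set.ncard_image_of_injective _ hinj] at h₂
  lia

theorem omega_add_le_omega_sdiff (hm : 0 < m) (G : SimpleGraph V) {W : Set V} {u : V}
    (hu : u ∈ W) :
    Omega m (G.induce W) + {z ∈ W \ compIn m G W u | G.Adj u z}.ncard +
      Omega m (G.induce (compIn m G W u \ {u})) ≤ Omega m (G.induce (W \ {u})) + m := by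
  have h₁ := ncard_comps_sdiff m G hu
  have h₂ := ncard_crossIn_sdiff m G hu
  rw [omega_induce hm, omega_induce hm, omega_induce hm]
  have h₃ := Nat.mul_le_mul_left m h₁
  zify at h₂ h₃
  lia

theorem omega_lt_omega_sdiff (hm : 0 < m) {W : Set V} {u : V} (hu : u ∈ W)
    (hout : (if compIn m G W u = {u} then m + 1 else 1) ≤
      {z ∈ W \ compIn m G W u | G.Adj u z}.ncard) :
    Omega m (G.induce W) + 1 ≤ Omega m (G.induce (W \ {u})) := by
  have h := omega_add_le_omega_sdiff hm G hu
  split_ifs at hout with hX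
  · have h₀ : Omega m (G.induce (compIn m G W u \ {u})) = 0 := by
      have hcross : crossIn m G ∅ = ∅ := by
        ext e
        induction e with
        | _ x y => simp [mk_mem_crossIn]
      simp [omega_induce hm, hX, hcross]
    lia
  · have : Nonempty ↥(compIn m G W u \ {u}) := by
      rw [Set.nonempty_coe_sort, Set.sdiff_nonempty]
      exact fun h => hX (h.antisymm (Set.singleton_subset_iff.2 (mem_compIn_self m G hu)))
    have := le_omega hm (G.induce (compIn m G W u \ {u}))
    lia

theorem exists_omega_lt_omega_sdiff (hm : 0 < m) {W : Set V} {v w : W}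
    (hv : ¬IsTreeConn m ((G.induce W).induce
      {x | (G.induce W).connectedComponentMk x = (G.induce W).connectedComponentMk v}))
    (hwv : (G.induce W).connectedComponentMk w = (G.induce W).connectedComponentMk v)
    (hw : m < ((G.induce W).neighborSet w).ncard) :
    ∃ u ∈ W, Omega m (G.induce W) + 1 ≤ Omega m (G.induce (W \ {u})) := by
  by_cases hX : compIn m G W w = {w.1}
  · refine ⟨w, w.2, omega_lt_omega_sdiff hm w.2 ?_⟩
    rw [if_pos hX, hX]
    refine hw.trans_le ?_
    rw [← Set.ncard_image_of_injective _ Subtype.val_injective]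
    refine Set.ncard_le_ncard ?_ (Set.toFinite _)
    rintro _ ⟨z, hz, rfl⟩
    have hz : G.Adj w z := hz
    exact ⟨⟨z.2, hz.ne'⟩, hz⟩
  · have hwX := mem_compIn_self m G w.2
    rw [isTreeConn_induce_iff hm, treeConnOn_induce_iff] at hv
    obtain ⟨u, huX, z, hzW, hzX, huz⟩ : ∃ u ∈ compIn m G W w, ∃ z ∈ W,
        z ∉ compIn m G W w ∧ G.Adj u z := by
      by_contra! hclosed
      refine hv ?_
      convert treeConnOn_compIn m G w.2
      refine Set.Subset.antisymm ?_ ?_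
      · rintro _ ⟨x, hx, rfl⟩
        have hreach : (G.induce W).Reachable w x := ConnectedComponent.exact (hwv.trans hx.symm)
        rw [reachable_iff_reflTransGen] at hreach
        clear hx
        induction hreach with
        | refl => exact hwX
        | @tail b c _ hbc ih =>
          by_contra hc
          exact hclosed b ih c c.2 hc hbc
      · intro x hx
        obtain ⟨-, A, hAG, hAU, hA, -⟩ := treeConnOn_compIn m G w.2
        have hxW := compIn_subset m G W w hx
        refine ⟨⟨x, hxW⟩, ?_, rfl⟩
        refine Eq.trans ?_ hwv
        refine ConnectedComponent.sound (Reachable.mono (fun a b h => hAG ⟨0, hm⟩ h)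
          (reachable_comap_subtype
            (fun a b h => compIn_subset m G W w (hAU ⟨0, hm⟩ a b h).2)
            (hA ⟨0, hm⟩ x hx w hwX) hxW w.2))
    have huW := compIn_subset m G W w huX
    refine ⟨u, huW, omega_lt_omega_sdiff hm huW ?_⟩
    rw [compIn_eq_of_mem huX, if_neg, Nat.one_le_iff_ne_zero, ← Nat.pos_iff_ne_zero,
      Set.ncard_pos (Set.toFinite _)]
    · exact ⟨z, ⟨hzW, hzX⟩, huz⟩
    · intro h
      have hwu : w.1 = u := by rwa [h] at hwX
      exact hX (h.trans (by rw [hwu]))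

end Deletion

theorem stmt18 {V : Type*} [Fintype V] (m : ℕ) (hm : 0 < m) (ε : ℝ) (hε : ε ≤ 1)
    (G : SimpleGraph V) (S : Set V)
    (hmax : ∀ S' : Set V,
      (Omega m (G.induce S'ᶜ) : ℝ) - ε * S'.ncard ≤
        (Omega m (G.induce Sᶜ) : ℝ) - ε * S.ncard)
    (hcard : ∀ S' : Set V,
      (Omega m (G.induce S'ᶜ) : ℝ) - ε * S'.ncard =
        (Omega m (G.induce Sᶜ) : ℝ) - ε * S.ncard → S'.ncard ≤ S.ncard) :
    ∀ v : ↥Sᶜ,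
      IsTreeConn m ((G.induce Sᶜ).induce
        {w | (G.induce Sᶜ).connectedComponentMk w = (G.induce Sᶜ).connectedComponentMk v}) ∨
      ∀ w : ↥Sᶜ,
        (G.induce Sᶜ).connectedComponentMk w = (G.induce Sᶜ).connectedComponentMk v →
        ((G.induce Sᶜ).neighborSet w).ncard ≤ m := by
  intro v
  by_contra! h
  obtain ⟨hv, w, hwv, hw⟩ := h
  obtain ⟨u, hu, hlt⟩ := exists_omega_lt_omega_sdiff hm hv hwv hw
  have hset : (insert u S)ᶜ = Sᶜ \ {u} := by
    ext x
    simp [and_comm]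
  have hncard : (insert u S).ncard = S.ncard + 1 := Set.ncard_insert_of_notMem hu (Set.toFinite _)
  have hle := hmax (insert u S)
  have hge := hcard (insert u S)
  rw [hset, hncard] at hle hge
  have hlt' : (Omega m (G.induce Sᶜ) : ℝ) + 1 ≤ Omega m (G.induce (Sᶜ \ {u})) := by
    exact_mod_cast hlt
  push_cast at hle hge
  have := hge (by linarith)
  lia
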